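/- arXiv:2409.06977 — 7 statements merged into one kernel-verified Lean document; each statement's English description precedes it below -/
import Mathlib

section
/- Let Q be a preorder, (P,c) a Q-poset, and v ∈ P. For any two elements u and u' of the unfolding u(P) (i.e., covering chains starting at a minimal element of P) whose last element is v, the upper cones u(P)↾u and u(P)↾u' are isomorphic as Q-posets, i.e., there is an order isomorphism between them that preserves labels. -/
/-- An element of the unfolding `u(P)` of a poset `P`: a finite covering chain
`v₁ v₂ … v_t` in `P` (represented as a list) such that `v₁` is a minimal element
of `P` and each `v_{i+1}` is an immediate successor (cover) of `v_i`. -/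
def IsUChain {P : Type*} [PartialOrder P] (l : List P) : Prop :=
  l ≠ [] ∧ (∀ x ∈ l.head?, IsMin x) ∧ l.Chain' (· ⋖ ·)

/-- The underlying set of the unfolding `u(P)` of a poset `P`. -/
def Unf (P : Type*) [PartialOrder P] : Type _ := {l : List P // IsUChain l}

/-- The unfolding is ordered by the prefix relation on covering chains. -/
instance {P : Type*} [PartialOrder P] : PartialOrder (Unf P) where
  le a b := a.1 <+: b.1
  le_refl a := List.prefix_refl a.1
  le_trans _ _ _ hab hbc := List.IsPrefix.trans hab hbc
  le_antisymm a b hab hba :=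
    Subtype.ext (hab.eq_of_length (Nat.le_antisymm hab.length_le hba.length_le))

/-- The last element of a covering chain. -/
def lastOf {P : Type*} [PartialOrder P] (l : Unf P) : P := l.1.getLast l.2.1

/-- The labeling of the unfolding `u(P)` induced by a labeling `c` of `P`:
a chain is labeled by the label of its last element. -/
def unfLabel {P Q : Type*} [PartialOrder P] (c : P → Q) (l : Unf P) : Q := c (lastOf l)

/-- The `h`-preorder: `Hle cA cB` holds iff there is a morphism of `Q`-posets,
i.e. a monotone map `f` with `cA x ≤ cB (f x)` for all `x`. -/
def Hle {A B Q : Type*} [Preorder A] [Preorder B] [Preorder Q]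
    (cA : A → Q) (cB : B → Q) : Prop :=
  ∃ f : A → B, Monotone f ∧ ∀ x, cA x ≤ cB (f x)

/-- Whether a covering chain `u` can be prolonged by `t` depends only on the last element of `u`. -/
theorem isUChain_append_iff {P : Type*} [PartialOrder P] (u : Unf P) (t : List P) :
    IsUChain (u.1 ++ t) ↔ t.IsChain (· ⋖ ·) ∧ ∀ y ∈ t.head?, lastOf u ⋖ y := by
  obtain ⟨l, hne, hmin, hchain⟩ := u
  have hchain' : l.IsChain (· ⋖ ·) := hchain
  have hhead : (l ++ t).head? = l.head? := List.head?_append_of_ne_nil l hne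
  change _ ∧ _ ∧ List.IsChain _ _ ↔ _
  simp [List.isChain_append, hne, hhead, hchain', lastOf, List.getLast?_eq_getLast_of_ne_nil hne]
  exact fun _ _ => by simpa using hmin

/-- Every chain above `u` is `u` followed by its remaining part. -/
theorem append_drop_of_le {P : Type*} [PartialOrder P] {u w : Unf P} (h : u ≤ w) :
    u.1 ++ w.1.drop u.1.length = w.1 :=
  List.prefix_iff_eq_append.mp h

/-- Replace the initial part `u` of a chain above `u` by a chain `u'` with the same last element. -/
def regraft {P : Type*} [PartialOrder P] {u u' : Unf P} (h : lastOf u = lastOf u')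
    (w : {w : Unf P // u ≤ w}) : {w : Unf P // u' ≤ w} :=
  ⟨⟨u'.1 ++ w.1.1.drop u.1.length, by
    rw [isUChain_append_iff, ← h, ← isUChain_append_iff, append_drop_of_le w.2]
    exact w.1.2⟩, List.prefix_append _ _⟩

theorem regraft_regraft {P : Type*} [PartialOrder P] {u u' : Unf P} (h : lastOf u = lastOf u')
    (w : {w : Unf P // u ≤ w}) : regraft h.symm (regraft h w) = w := by
  apply Subtype.ext
  apply Subtype.ext
  simpa [regraft] using append_drop_of_le w.2

theorem regraft_mono {P : Type*} [PartialOrder P] {u u' : Unf P} (h : lastOf u = lastOf u') :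
    Monotone (regraft h) := fun _ _ hab =>
  (List.prefix_append_right_inj u'.1).mpr (List.IsPrefix.drop hab u.1.length)

theorem lastOf_regraft {P : Type*} [PartialOrder P] {u u' : Unf P} (h : lastOf u = lastOf u')
    (w : {w : Unf P // u ≤ w}) : lastOf (regraft h w).1 = lastOf w.1 := by
  obtain ⟨⟨l, hw⟩, hle⟩ := w
  obtain ⟨t, rfl⟩ : ∃ t, u.1 ++ t = l := hle
  rcases eq_or_ne t [] with rfl | ht
  · simpa [regraft, lastOf] using h.symm
  · simp [regraft, lastOf, List.getLast_append_of_ne_nil, ht]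

/-- Chains with the same last element have isomorphic upper cones in the unfolding. -/
def regraftIso {P : Type*} [PartialOrder P] {u u' : Unf P} (h : lastOf u = lastOf u') :
    {w : Unf P // u ≤ w} ≃o {w : Unf P // u' ≤ w} :=
  Equiv.toOrderIso ⟨regraft h, regraft h.symm, regraft_regraft h, regraft_regraft h.symm⟩
    (regraft_mono h) (regraft_mono h.symm)

/-- For any two elements `u, u'` of the unfolding `u(P)` whose last
element is `v`, the upper cones `u(P)↾u` and `u(P)↾u'` are isomorphic as `Q`-posets
(there is an order isomorphism preserving the labels). -/
theorem stmt_0 {Q : Type*} [Preorder Q] {P : Type*} [PartialOrder P] [Fintype P] [Nonempty P]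
    (c : P → Q) (v : P) (u u' : Unf P) (hu : lastOf u = v) (hu' : lastOf u' = v) :
    ∃ e : {w : Unf P // u ≤ w} ≃o {w : Unf P // u' ≤ w},
      ∀ w : {w : Unf P // u ≤ w}, unfLabel c (e w).1 = unfLabel c w.1 := by
  have h : lastOf u = lastOf u' := hu.trans hu'.symm
  exact ⟨regraftIso h, fun w => congrArg c (lastOf_regraft h w)⟩
end

section
/- Let Q be a preorder and (P_1,c_1), (P_2,c_2) be Q-posets, v_1 ∈ P_1, v_2 ∈ P_2. Then u(P_1↾v_1) ≤_h u(P_2↾v_2) if and only if either (i) there exists an immediate successor u_2 of v_2 in P_2 such that u(P_1↾v_1) ≤_h u(P_2↾u_2), or (ii) c_1(v_1) ≤ c_2(v_2) in Q and for every immediate successor u_1 of v_1 in P_1 we have u(P_1↾u_1) ≤_h u(P_2↾v_2). -/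
theorem Hle.trans {A B C Q : Type*} [Preorder A] [Preorder B] [Preorder C] [Preorder Q]
    {a : A → Q} {b : B → Q} {c : C → Q} : Hle a b → Hle b c → Hle a c
  | ⟨f, hf, hf'⟩, ⟨g, hg, hg'⟩ => ⟨g ∘ f, hg.comp hf, fun x => (hf' x).trans (hg' (f x))⟩

/-- Covering chains starting at `v`, represented by their tails. -/
def CoverTail {P : Type*} [PartialOrder P] (v : P) : Type _ :=
  {t : List P // (v :: t).IsChain (· ⋖ ·)}

instance {P : Type*} [PartialOrder P] (v : P) : Preorder (CoverTail v) where
  le a b := a.1 <+: b.1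
  le_refl a := List.prefix_refl a.1
  le_trans _ _ _ hab hbc := List.IsPrefix.trans hab hbc

namespace CoverTail

variable {P R Q : Type*} [PartialOrder P] [PartialOrder R]

/-- A covering chain is labeled by the label of its last element. -/
def label (c : P → Q) (v : P) (t : CoverTail v) : Q :=
  c ((v :: t.1).getLast (List.cons_ne_nil _ _))

/-- The chain consisting of the starting point only. -/
def root (v : P) : CoverTail v := ⟨[], List.isChain_singleton v⟩

/-- Prepend a starting point covered by the given one. -/
def cons {v u : P} (h : v ⋖ u) (t : CoverTail u) : CoverTail v :=
  ⟨u :: t.1, List.isChain_cons_cons.2 ⟨h, t.2⟩⟩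

theorem label_cons (c : P → Q) {v u : P} (h : v ⋖ u) (t : CoverTail u) :
    label c v (cons h t) = label c u t := rfl

theorem root_le {v : P} (t : CoverTail v) : root v ≤ t := List.nil_prefix

theorem not_cons_le_root {v u : P} (h : v ⋖ u) (t : CoverTail u) : ¬ cons h t ≤ root v :=
  fun hle => List.cons_ne_nil _ _ (List.prefix_nil.1 hle)

theorem cons_le_cons_iff {v u : P} (h : v ⋖ u) {s t : CoverTail u} :
    cons h s ≤ cons h t ↔ s ≤ t := List.prefix_cons_inj u

theorem eq_of_cons_le_cons {v u w : P} {h : v ⋖ u} {h' : v ⋖ w} {s : CoverTail u}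
    {t : CoverTail w} (hle : cons h s ≤ cons h' t) : u = w :=
  (List.cons_prefix_cons.1 hle).1

theorem eq_root_or_eq_cons {v : P} :
    ∀ t : CoverTail v, t = root v ∨ ∃ (u : P) (h : v ⋖ u) (s : CoverTail u), t = cons h s
  | ⟨[], _⟩ => Or.inl rfl
  | ⟨u :: l, hl⟩ =>
    Or.inr ⟨u, (List.isChain_cons_cons.1 hl).1, ⟨l, (List.isChain_cons_cons.1 hl).2⟩, rfl⟩

/-- Define a map on covering chains from its value at the root and on the subtrees. -/
def elim {β : Type*} {v : P} (b : β) (g : ∀ u, v ⋖ u → CoverTail u → β) : CoverTail v → β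
  | ⟨[], _⟩ => b
  | ⟨u :: l, hl⟩ => g u (List.isChain_cons_cons.1 hl).1 ⟨l, (List.isChain_cons_cons.1 hl).2⟩

theorem hle_of_covBy [Preorder Q] (c : P → Q) {v u : P} (h : v ⋖ u) : Hle (label c u) (label c v) :=
  ⟨cons h, fun _ _ => (cons_le_cons_iff h).2, fun _ => le_rfl⟩

theorem hle_iff [Preorder Q] (c : P → Q) (c' : R → Q) (v : P) (v' : R) :
    Hle (label c v) (label c' v') ↔
      (∃ u', v' ⋖ u' ∧ Hle (label c v) (label c' u')) ∨
        (c v ≤ c' v' ∧ ∀ u, v ⋖ u → Hle (label c u) (label c' v')) := by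
  constructor
  · rintro ⟨f, hf, hfc⟩
    obtain hr | ⟨u', h, s, hs⟩ := eq_root_or_eq_cons (f (root v))
    · refine Or.inr ⟨?_, fun u hu => (hle_of_covBy c hu).trans ⟨f, hf, hfc⟩⟩
      have := hfc (root v)
      rwa [hr] at this
    · refine Or.inl ⟨u', h, ?_⟩
      have key : ∀ x, ∃ t : CoverTail u', f x = cons h t := fun x => by
        have hle := hf (root_le x)
        rw [hs] at hle
        obtain hx | ⟨w, hw, t, ht⟩ := eq_root_or_eq_cons (f x)
        · exact absurd (hx ▸ hle) (not_cons_le_root h s)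
        · rw [ht] at hle
          obtain rfl := eq_of_cons_le_cons hle
          exact ⟨t, ht⟩
      choose g hg using key
      refine ⟨g, fun x y hxy => ?_, fun x => ?_⟩
      · rw [← cons_le_cons_iff h, ← hg, ← hg]
        exact hf hxy
      · rw [← label_cons c' h, ← hg]
        exact hfc x
  · rintro (⟨u', h, H⟩ | ⟨hv, H⟩)
    · exact H.trans (hle_of_covBy c' h)
    · choose g hg hgc using H
      refine ⟨elim (root v') g, fun x y hxy => ?_, fun x => ?_⟩
      · obtain rfl | ⟨u, h, s, rfl⟩ := eq_root_or_eq_cons x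
        · exact root_le _
        · obtain rfl | ⟨w, hw, t, rfl⟩ := eq_root_or_eq_cons y
          · exact absurd hxy (not_cons_le_root h s)
          · obtain rfl := eq_of_cons_le_cons hxy
            exact hg u h ((cons_le_cons_iff h).1 hxy)
      · obtain rfl | ⟨u, h, s, rfl⟩ := eq_root_or_eq_cons x
        · exact hv
        · exact hgc u h s

theorem subtype_covBy_iff {v : P} {a b : {w : P // v ≤ w}} : a ⋖ b ↔ a.1 ⋖ b.1 :=
  ⟨fun h => ⟨h.1, fun x hax hxb => h.2 (c := ⟨x, a.2.trans hax.le⟩) hax hxb⟩,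
    fun h => ⟨h.1, fun _ hax hxb => h.2 hax hxb⟩⟩

theorem le_of_mem {v : P} (t : CoverTail v) : ∀ x ∈ v :: t.1, v ≤ x := by
  have h : (v :: t.1).IsChain (· ≤ ·) := t.2.imp fun _ _ h => h.le
  intro x hx
  obtain rfl | hx := List.mem_cons.1 hx
  · exact le_rfl
  · exact h.rel_cons hx

theorem map_val_eq {v : P} (l : Unf {w : P // v ≤ w}) :
    ∃ t : CoverTail v, l.1.map Subtype.val = v :: t.1 := by
  obtain ⟨_ | ⟨a, l⟩, hne, hmin, hch⟩ := l
  · exact absurd rfl hne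
  · have ha : a.1 = v :=
      le_antisymm (hmin a rfl (b := ⟨v, le_rfl⟩) a.2) a.2
    have hmap : ((a :: l).map Subtype.val).IsChain (· ⋖ ·) :=
      (List.isChain_map _).2 (hch.imp fun _ _ h => subtype_covBy_iff.1 h)
    rw [List.map_cons, ha] at hmap
    exact ⟨⟨l.map Subtype.val, hmap⟩, by rw [List.map_cons, ha]⟩

theorem exists_unf {v : P} (t : CoverTail v) :
    ∃ l : Unf {w : P // v ≤ w}, l.1.map Subtype.val = v :: t.1 := by
  obtain ⟨l, hl⟩ : ∃ l : List {w : P // v ≤ w}, l.map Subtype.val = v :: t.1 :=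
    ⟨(v :: t.1).pmap Subtype.mk t.le_of_mem, by simp [List.map_pmap]⟩
  refine ⟨⟨l, ?_, ?_, ?_⟩, hl⟩
  · rintro rfl
    simp at hl
  · intro x hx y _
    have hxv : x.1 = v := by
      have hhead := congrArg List.head? hl
      rw [List.head?_map, Option.mem_def.1 hx] at hhead
      exact Option.some.inj hhead
    exact hxv.le.trans y.2
  · have ht := t.2
    rw [← hl, List.isChain_map] at ht
    exact ht.imp fun _ _ h => subtype_covBy_iff.2 h

theorem unfLabel_eq_label (c : P → Q) {v : P} {l : Unf {w : P // v ≤ w}} {t : CoverTail v}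
    (h : l.1.map Subtype.val = v :: t.1) :
    unfLabel (fun w : {w : P // v ≤ w} => c w.1) l = label c v t := by
  simp only [unfLabel, lastOf, label, ← h, List.getLast_map]

theorem unf_le_iff {v : P} {l m : Unf {w : P // v ≤ w}} {s t : CoverTail v}
    (hl : l.1.map Subtype.val = v :: s.1) (hm : m.1.map Subtype.val = v :: t.1) :
    l ≤ m ↔ s ≤ t := by
  change l.1 <+: m.1 ↔ s.1 <+: t.1
  rw [← List.prefix_cons_inj v, ← hl, ← hm,
    List.prefix_map_iff_of_injective Subtype.val_injective]

theorem hle_unfLabel [Preorder Q] (c : P → Q) (v : P) :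
    Hle (label c v) (unfLabel fun w : {w : P // v ≤ w} => c w.1) := by
  choose f hf using exists_unf (v := v)
  exact ⟨f, fun s t => (unf_le_iff (hf s) (hf t)).2, fun t => (unfLabel_eq_label c (hf t)).ge⟩

theorem unfLabel_hle [Preorder Q] (c : P → Q) (v : P) :
    Hle (unfLabel fun w : {w : P // v ≤ w} => c w.1) (label c v) := by
  choose f hf using map_val_eq (v := v)
  exact ⟨f, fun l m => (unf_le_iff (hf l) (hf m)).1, fun l => (unfLabel_eq_label c (hf l)).le⟩

theorem unfLabel_hle_unfLabel_iff [Preorder Q] (c : P → Q) (c' : R → Q) (v : P) (v' : R) :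
    Hle (unfLabel fun w : {w : P // v ≤ w} => c w.1)
      (unfLabel fun w : {w : R // v' ≤ w} => c' w.1) ↔ Hle (label c v) (label c' v') :=
  ⟨fun h => ((hle_unfLabel c v).trans h).trans (unfLabel_hle c' v'),
    fun h => ((unfLabel_hle c v).trans h).trans (hle_unfLabel c' v')⟩

end CoverTail

/-- `u(P₁↾v₁) ≤_h u(P₂↾v₂)` iff either some immediate successor `u₂`
of `v₂` satisfies `u(P₁↾v₁) ≤_h u(P₂↾u₂)`, or `c₁ v₁ ≤ c₂ v₂` and every immediate
successor `u₁` of `v₁` satisfies `u(P₁↾u₁) ≤_h u(P₂↾v₂)`. -/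
theorem stmt_2 {Q : Type*} [Preorder Q] {P₁ P₂ : Type*}
    [PartialOrder P₁] [Fintype P₁] [Nonempty P₁]
    [PartialOrder P₂] [Fintype P₂] [Nonempty P₂]
    (c₁ : P₁ → Q) (c₂ : P₂ → Q) (v₁ : P₁) (v₂ : P₂) :
    Hle (unfLabel fun w : {w : P₁ // v₁ ≤ w} => c₁ w.1)
        (unfLabel fun w : {w : P₂ // v₂ ≤ w} => c₂ w.1) ↔
      ((∃ u₂ : P₂, v₂ ⋖ u₂ ∧
          Hle (unfLabel fun w : {w : P₁ // v₁ ≤ w} => c₁ w.1)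
              (unfLabel fun w : {w : P₂ // u₂ ≤ w} => c₂ w.1)) ∨
        (c₁ v₁ ≤ c₂ v₂ ∧ ∀ u₁ : P₁, v₁ ⋖ u₁ →
          Hle (unfLabel fun w : {w : P₁ // u₁ ≤ w} => c₁ w.1)
              (unfLabel fun w : {w : P₂ // v₂ ≤ w} => c₂ w.1))) := by
  simpa only [CoverTail.unfLabel_hle_unfLabel_iff] using CoverTail.hle_iff c₁ c₂ v₁ v₂
end

section
/- Let M be a deterministic automaton with n states over an alphabet of size d ≥ 1. Then the number of cycles of M satisfies |C_M| ≤ max(2^d, C^n + n), where C = 2·(1 − 1/2^{d+1})^{1/(d+1)} (note C < 2). -/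
/-- Extension of the transition function of an automaton to finite words:
`fext f q w` is the state reached from `q` after reading the word `w`. -/
def fext {S X : Type*} (f : S → X → S) (q : S) (w : List X) : S := w.foldl f q

/-- `Reach f p q` : the state `q` is reachable from the state `p`. -/
def Reach {S X : Type*} (f : S → X → S) (p q : S) : Prop := ∃ w : List X, fext f p w = q

/-- The run of an automaton with transition function `f` and initial state `init`
on the ω-word `ξ`. -/
def run {S X : Type*} (f : S → X → S) (init : S) (ξ : ℕ → X) : ℕ → S
  | 0 => init
  | n + 1 => f (run f init ξ n) (ξ n)

/-- `infOcc f init ξ = f_M(ξ)` : the set of states occurring infinitely often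
in the run of the automaton on the ω-word `ξ`. -/
def infOcc {S X : Type*} (f : S → X → S) (init : S) (ξ : ℕ → X) : Set S :=
  {q | {n : ℕ | run f init ξ n = q}.Infinite}

/-- `cycles f init = C_M` : the set of cycles (loops) of the automaton. -/
def cycles {S X : Type*} (f : S → X → S) (init : S) : Set (Set S) :=
  {c | ∃ ξ : ℕ → X, infOcc f init ξ = c}

open Finset

/-- Mahler's inequality for two products, in a division-free form. -/
theorem add_pow_le_mul_prod_add {ι : Type*} (I : Finset ι) (hI : I.Nonempty) (u v : ι → ℝ)
    (hu : ∀ i ∈ I, 0 ≤ u i) (hv : ∀ i ∈ I, 0 ≤ v i) {p x y : ℝ} (hp : 0 ≤ p)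
    (hx : 0 ≤ x) (hy : 0 ≤ y) (hxu : x ^ #I ≤ p * ∏ i ∈ I, u i)
    (hyv : y ^ #I ≤ p * ∏ i ∈ I, v i) :
    (x + y) ^ #I ≤ p * ∏ i ∈ I, (u i + v i) := by
  have hk : #I ≠ 0 := hI.card_ne_zero
  have hk' : (0 : ℝ) < #I := by exact_mod_cast hI.card_pos
  have hT : 0 ≤ p * ∏ i ∈ I, (u i + v i) :=
    mul_nonneg hp (prod_nonneg fun i hi => add_nonneg (hu i hi) (hv i hi))
  rcases hT.eq_or_lt with h0 | hpos
  · have h1 : x ^ #I ≤ 0 := by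
      rw [h0]
      refine hxu.trans (mul_le_mul_of_nonneg_left (prod_le_prod hu fun i hi => ?_) hp)
      linarith [hv i hi]
    have h2 : y ^ #I ≤ 0 := by
      rw [h0]
      refine hyv.trans (mul_le_mul_of_nonneg_left (prod_le_prod hv fun i hi => ?_) hp)
      linarith [hu i hi]
    have h1' : x = 0 := eq_zero_of_pow_eq_zero (le_antisymm h1 (pow_nonneg hx _))
    have h2' : y = 0 := eq_zero_of_pow_eq_zero (le_antisymm h2 (pow_nonneg hy _))
    rw [← h0, h1', h2', add_zero, zero_pow hk]
  · set T := p * ∏ i ∈ I, (u i + v i) with hTdef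
    have hne : ∀ i ∈ I, u i + v i ≠ 0 :=
      prod_ne_zero_iff.mp (right_ne_zero_of_mul hpos.ne')
    obtain ⟨t, ht, htT⟩ : ∃ t : ℝ, 0 < t ∧ t ^ #I = T :=
      ⟨T ^ (1 / (#I : ℝ)), Real.rpow_pos_of_pos hpos _, by
        rw [← Real.rpow_natCast, ← Real.rpow_mul hpos.le, one_div_mul_cancel hk'.ne',
          Real.rpow_one]⟩
    have key : ∀ (w : ι → ℝ) (z : ℝ), (∀ i ∈ I, 0 ≤ w i) → 0 ≤ z →
        z ^ #I ≤ p * ∏ i ∈ I, w i → z ≤ t * ((∑ i ∈ I, w i / (u i + v i)) / #I) := by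
      intro w z hw hz hzw
      have hr : ∀ i ∈ I, 0 ≤ w i / (u i + v i) := fun i hi =>
        div_nonneg (hw i hi) (add_nonneg (hu i hi) (hv i hi))
      have amgm := Real.geom_mean_le_arith_mean_weighted I (fun _ => 1 / (#I : ℝ))
        (fun i => w i / (u i + v i)) (fun _ _ => by positivity)
        (by simp [hk'.ne']) hr
      rw [Real.finsetProd_rpow I _ hr, ← mul_sum, one_div_mul_eq_div] at amgm
      refine le_trans ?_ (mul_le_mul_of_nonneg_left amgm ht.le)
      have hprod := prod_nonneg hr
      refine le_of_pow_le_pow_left₀ hk (mul_nonneg ht.le (Real.rpow_nonneg hprod _)) ?_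
      rw [mul_pow, htT, ← Real.rpow_natCast (_ ^ _), ← Real.rpow_mul hprod,
        one_div_mul_cancel hk'.ne', Real.rpow_one, prod_div_distrib, hTdef, mul_assoc,
        mul_div_cancel₀ _ (prod_ne_zero_iff.mpr hne)]
      exact hzw
    have hsum : x + y ≤ t := by
      have h := add_le_add (key u x hu hx hxu) (key v y hv hy hyv)
      rw [← mul_add, ← add_div, ← sum_add_distrib, sum_congr rfl fun i hi => by
        rw [← add_div, div_self (hne i hi)], sum_const, nsmul_one, div_self hk'.ne', mul_one] at h
      exact h
    rw [← htT]
    exact pow_le_pow_left₀ (add_nonneg hx hy) hsum _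

/-- Shearer's inequality for set families: if every element of the ground set lies in exactly
`k` of the sets `B i`, then `|F| ^ k` is at most the product of the sizes of the traces of `F`. -/
theorem card_pow_le_prod_card_trace {α ι : Type*} [DecidableEq α] [Fintype ι]
    (B : ι → Finset α) {k : ℕ} (hk : k ≠ 0) (A : Finset α)
    (hA : ∀ a ∈ A, #{i | a ∈ B i} = k) (F : Finset (Finset α)) (hF : ∀ s ∈ F, s ⊆ A) :
    #F ^ k ≤ ∏ i, #(F.image (· ∩ B i)) := by
  induction A using Finset.induction_on generalizing F with
  | empty =>
    rcases F.eq_empty_or_nonempty with rfl | hne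
    · simp [hk]
    · have h1 : #F ≤ 1 := (card_le_card fun s hs => mem_singleton.mpr
        (subset_empty.mp (hF s hs))).trans (card_singleton (∅ : Finset α)).le
      calc #F ^ k ≤ 1 := pow_le_one₀ (Nat.zero_le _) h1
        _ ≤ _ := one_le_prod' fun i _ => (hne.image _).card_pos
  | insert a A ha ih =>
    have hA' : ∀ b ∈ A, #{i | b ∈ B i} = k := fun b hb => hA b (mem_insert_of_mem hb)
    have h0 := ih hA' (F.nonMemberSubfamily a) fun s hs => by
      rw [mem_nonMemberSubfamily] at hs
      exact (subset_insert_iff_of_notMem hs.2).mp (hF s hs.1)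
    have h1 := ih hA' (F.memberSubfamily a) fun s hs => by
      rw [mem_memberSubfamily] at hs
      exact (subset_insert_iff_of_notMem hs.2).mp ((subset_insert a s).trans (hF _ hs.1))
    have hmem : ∀ i, a ∈ B i → #((F.memberSubfamily a).image (· ∩ B i)) +
        #((F.nonMemberSubfamily a).image (· ∩ B i)) ≤ #(F.image (· ∩ B i)) := by
      intro i hi
      rw [← card_memberSubfamily_add_card_nonMemberSubfamily a (F.image (· ∩ B i))]
      refine add_le_add (card_le_card ?_) (card_le_card ?_)
      · intro s hs
        obtain ⟨t, ht, rfl⟩ := mem_image.mp hs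
        rw [mem_memberSubfamily] at ht ⊢
        refine ⟨mem_image.mpr ⟨_, ht.1, ?_⟩, fun h => ht.2 (mem_inter.mp h).1⟩
        exact insert_inter_of_mem hi
      · intro s hs
        obtain ⟨t, ht, rfl⟩ := mem_image.mp hs
        rw [mem_nonMemberSubfamily] at ht ⊢
        exact ⟨mem_image_of_mem _ ht.1, fun h => ht.2 (mem_inter.mp h).1⟩
    have hnot0 : ∀ i, #((F.nonMemberSubfamily a).image (· ∩ B i)) ≤ #(F.image (· ∩ B i)) :=
      fun i => card_le_card (image_subset_image fun s hs => (mem_nonMemberSubfamily.mp hs).1)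
    have hnot1 : ∀ i, a ∉ B i →
        #((F.memberSubfamily a).image (· ∩ B i)) ≤ #(F.image (· ∩ B i)) := by
      intro i hi
      refine card_le_card fun s hs => ?_
      obtain ⟨t, ht, rfl⟩ := mem_image.mp hs
      exact mem_image.mpr ⟨_, (mem_memberSubfamily.mp ht).1, insert_inter_of_notMem hi⟩
    have hcard : #{i | a ∈ B i} = k := hA a (mem_insert_self a A)
    have hI : ({i | a ∈ B i} : Finset ι).Nonempty := card_pos.mp (by omega)
    have split : ∀ g : ι → ℕ, ∏ i, g i = (∏ i with a ∉ B i, g i) * ∏ i with a ∈ B i, g i :=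
      fun g => by rw [mul_comm, prod_filter_mul_prod_filter_not]
    rw [split] at h0 h1
    have h0' := h0.trans (Nat.mul_le_mul_right _ (prod_le_prod' fun i _ => hnot0 i))
    have h1' := h1.trans (Nat.mul_le_mul_right _
      (prod_le_prod' fun i hi => hnot1 i (mem_filter.mp hi).2))
    have mahler := add_pow_le_mul_prod_add _ hI
      (fun i => (#((F.memberSubfamily a).image (· ∩ B i)) : ℝ))
      (fun i => (#((F.nonMemberSubfamily a).image (· ∩ B i)) : ℝ))
      (p := ∏ i with a ∉ B i, (#(F.image (· ∩ B i)) : ℝ))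
      (x := #(F.memberSubfamily a)) (y := #(F.nonMemberSubfamily a))
      (fun _ _ => Nat.cast_nonneg _) (fun _ _ => Nat.cast_nonneg _)
      (prod_nonneg fun _ _ => Nat.cast_nonneg _) (Nat.cast_nonneg _) (Nat.cast_nonneg _)
      (by rw [hcard]; exact_mod_cast h1') (by rw [hcard]; exact_mod_cast h0')
    rw [hcard] at mahler
    rw [split, ← card_memberSubfamily_add_card_nonMemberSubfamily a F]
    refine le_trans (by exact_mod_cast mahler) (Nat.mul_le_mul_left _
      (prod_le_prod' fun i hi => hmem i (mem_filter.mp hi).2))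

/-- Log-concavity of `b ↦ 2 ^ b - 1`, as a supporting-line inequality at `m`. -/
theorem two_pow_sub_one_mul_pow_le {m : ℕ} (hm : m ≠ 0) (b : ℕ) :
    ((2 : ℝ) ^ b - 1) * ((2 ^ (m + 1) - 1) / (2 ^ m - 1)) ^ m ≤
      (2 ^ m - 1) * ((2 ^ (m + 1) - 1) / (2 ^ m - 1)) ^ b := by
  have hm1 : (0 : ℝ) < 2 ^ m - 1 := sub_pos.mpr (one_lt_pow₀ one_lt_two hm)
  have hm2 : (0 : ℝ) < 2 ^ (m + 1) - 1 := sub_pos.mpr (one_lt_pow₀ one_lt_two m.succ_ne_zero)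
  set r : ℝ := (2 ^ (m + 1) - 1) / (2 ^ m - 1) with hr
  have hr0 : 0 < r := div_pos hm2 hm1
  rcases le_total m b with h | h
  · induction b, h using Nat.le_induction with
    | base => exact le_rfl
    | succ b hb ih =>
      have hpow : (2 : ℝ) ^ m ≤ 2 ^ b := pow_le_pow_right₀ one_le_two hb
      have hstep : (2 : ℝ) ^ (b + 1) - 1 ≤ (2 ^ b - 1) * r := by
        rw [hr, mul_div_assoc', le_div_iff₀ hm1, pow_succ, pow_succ]
        linarith
      calc ((2 : ℝ) ^ (b + 1) - 1) * r ^ m ≤ ((2 ^ b - 1) * r) * r ^ m := by gcongr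
        _ = ((2 ^ b - 1) * r ^ m) * r := by ring
        _ ≤ ((2 ^ m - 1) * r ^ b) * r := by gcongr
        _ = (2 ^ m - 1) * r ^ (b + 1) := by ring
  · induction h using Nat.decreasingInduction with
    | self => exact le_rfl
    | of_succ b hb ih =>
      have hpow : (2 : ℝ) ^ b ≤ 2 ^ m := pow_le_pow_right₀ one_le_two hb.le
      have hstep : (2 ^ b - 1) * r ≤ (2 : ℝ) ^ (b + 1) - 1 := by
        rw [hr, mul_div_assoc', div_le_iff₀ hm1, pow_succ, pow_succ]
        linarith
      refine le_of_mul_le_mul_right ?_ hr0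
      calc ((2 : ℝ) ^ b - 1) * r ^ m * r = ((2 ^ b - 1) * r) * r ^ m := by ring
        _ ≤ (2 ^ (b + 1) - 1) * r ^ m := by gcongr
        _ ≤ (2 ^ m - 1) * r ^ (b + 1) := ih
        _ = (2 ^ m - 1) * r ^ b * r := by ring

/-- A product of numbers `2 ^ b i - 1` with exponents of mean `m` is at most `(2 ^ m - 1) ^ n`. -/
theorem prod_two_pow_sub_one_le {ι : Type*} [Fintype ι] (b : ι → ℕ) {m : ℕ} (hm : m ≠ 0)
    (hb : ∑ i, b i = Fintype.card ι * m) :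
    ∏ i, ((2 : ℝ) ^ b i - 1) ≤ (2 ^ m - 1) ^ Fintype.card ι := by
  have hm1 : (0 : ℝ) < 2 ^ m - 1 := sub_pos.mpr (one_lt_pow₀ one_lt_two hm)
  have hm2 : (0 : ℝ) < 2 ^ (m + 1) - 1 := sub_pos.mpr (one_lt_pow₀ one_lt_two m.succ_ne_zero)
  have hr0 := div_pos hm2 hm1
  have h := prod_le_prod (s := univ)
    (fun i _ => mul_nonneg (sub_nonneg.mpr (one_le_pow₀ (one_le_two (α := ℝ)) (n := b i)))
      (pow_nonneg hr0.le m))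
    (fun i _ => two_pow_sub_one_mul_pow_le hm (b i))
  rw [prod_mul_distrib, prod_mul_distrib, prod_pow_eq_pow_sum _ b, hb, prod_const, prod_const,
    card_univ, ← pow_mul, mul_comm m] at h
  exact le_of_mul_le_mul_right h (pow_pos hr0 _)

/-- If every vertex `p` has exactly `d` out-neighbours `N p`, none of them `p` itself, this bounds
the number of vertex sets in which each vertex has an in-neighbour. -/
theorem card_filter_exists_inNeighbour_pow_le {S : Type*} [Fintype S] [DecidableEq S]
    (N : S → Finset S) {d : ℕ} (hN : ∀ p, #(N p) = d) (hself : ∀ p, p ∉ N p) :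
    (#{s : Finset S | ∀ q ∈ s, ∃ p ∈ s, q ∈ N p} : ℝ) ^ (d + 1) ≤
      (2 ^ (d + 1) - 1) ^ Fintype.card S := by
  set F : Finset (Finset S) := {s | ∀ q ∈ s, ∃ p ∈ s, q ∈ N p}
  let B : S → Finset S := fun q => insert q ({p | q ∈ N p} : Finset S)
  have hdeg : ∀ p, #{q | p ∈ B q} = d + 1 := by
    intro p
    rw [← hN p, ← card_insert_of_notMem (hself p)]
    congr 1
    ext q
    simp [B, eq_comm]
  have hsum : ∑ q, #(B q) = Fintype.card S * (d + 1) := by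
    have h := sum_card_bipartiteAbove_eq_sum_card_bipartiteBelow (s := univ) (t := univ)
      (fun p q => p ∈ B q)
    simp only [bipartiteAbove, bipartiteBelow, hdeg, sum_const, card_univ, smul_eq_mul,
      filter_univ_mem] at h
    exact h.symm
  have htrace : ∀ q, #(F.image (· ∩ B q)) + 1 ≤ 2 ^ #(B q) := by
    intro q
    have hsub : F.image (· ∩ B q) ⊆ (B q).powerset.erase {q} := by
      intro s hs
      obtain ⟨t, ht, rfl⟩ := mem_image.mp hs
      refine mem_erase.mpr ⟨fun h => ?_, mem_powerset.mpr inter_subset_right⟩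
      have hq : q ∈ t := (mem_inter.mp (h ▸ mem_singleton_self q)).1
      obtain ⟨p, hp, hqp⟩ := (mem_filter.mp ht).2 q hq
      have hpq : p ∈ t ∩ B q := by simp [B, hp, hqp]
      rw [h, mem_singleton] at hpq
      exact hself q (hpq ▸ hqp)
    have hq : ({q} : Finset S) ∈ (B q).powerset := by simp [B]
    rw [← card_powerset, ← card_erase_add_one hq]
    exact Nat.add_le_add_right (card_le_card hsub) 1
  have hshearer := card_pow_le_prod_card_trace B d.succ_ne_zero univ (fun p _ => hdeg p) F
    fun s _ => subset_univ s
  calc (#F : ℝ) ^ (d + 1) ≤ ∏ q, (#(F.image (· ∩ B q)) : ℝ) := by exact_mod_cast hshearer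
    _ ≤ ∏ q, ((2 : ℝ) ^ #(B q) - 1) := prod_le_prod (fun _ _ => Nat.cast_nonneg _) fun q _ => by
        rw [le_sub_iff_add_le]
        exact_mod_cast htrace q
    _ ≤ _ := prod_two_pow_sub_one_le _ d.succ_ne_zero hsum

/-- In a cycle other than `{q}`, the state `q` has a predecessor different from itself. -/
theorem exists_pred_of_mem_infOcc {S X : Type*} [Finite S] {f : S → X → S} {init : S}
    {ξ : ℕ → X} {q : S} (hq : q ∈ infOcc f init ξ) (hne : infOcc f init ξ ≠ {q}) :
    ∃ p ∈ infOcc f init ξ, p ≠ q ∧ ∃ x, f p x = q := by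
  obtain ⟨r, hr, hrq⟩ : ∃ r ∈ infOcc f init ξ, r ≠ q := by
    by_contra! h
    exact hne (Set.eq_singleton_iff_unique_mem.mpr ⟨hq, h⟩)
  obtain ⟨M, hM⟩ : ∃ M, ∀ n, M < n → run f init ξ n ∈ infOcc f init ξ := by
    have hfin : (⋃ p ∈ (infOcc f init ξ)ᶜ, {n | run f init ξ n = p}).Finite :=
      (Set.toFinite _).biUnion fun p hp => Set.not_infinite.mp hp
    obtain ⟨M, hM⟩ := hfin.bddAbove
    refine ⟨M, fun n hn => by_contra fun h => hn.not_ge (hM ?_)⟩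
    exact Set.mem_biUnion (x := run f init ξ n) h rfl
  obtain ⟨a, har, hMa⟩ := Set.Infinite.exists_gt hr M
  obtain ⟨b, hbq, hab⟩ := Set.Infinite.exists_gt hq a
  have har' : run f init ξ a ≠ q := fun h => hrq (har.symm.trans h)
  obtain ⟨n, hn, hnq, hsucc⟩ : ∃ n, a ≤ n ∧ run f init ξ n ≠ q ∧ run f init ξ (n + 1) = q := by
    by_contra! h
    exact (Nat.le_induction (P := fun n _ => run f init ξ n ≠ q) har' (fun n hn ih => h n hn ih)
      b hab.le) hbq
  exact ⟨_, hM n (hMa.trans_le hn), hnq, ξ n, hsucc⟩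

/-- For a deterministic automaton with `n` states over an alphabet of
size `d ≥ 1`, the number of cycles satisfies `|C_M| ≤ max (2^d) (C^n + n)` where
`C = 2·(1 − 1/2^(d+1))^(1/(d+1)) < 2`. -/
theorem stmt_4 {S X : Type*} [Fintype S] [Nonempty S] [Fintype X]
    (f : S → X → S) (init : S) (hd : 1 ≤ Fintype.card X) :
    (2 * ((1 : ℝ) - 1 / 2 ^ (Fintype.card X + 1)) ^ ((1 : ℝ) / ((Fintype.card X : ℝ) + 1)) < 2) ∧
    ((cycles f init).ncard : ℝ) ≤
      max ((2 : ℝ) ^ Fintype.card X)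
        ((2 * ((1 : ℝ) - 1 / 2 ^ (Fintype.card X + 1)) ^
            ((1 : ℝ) / ((Fintype.card X : ℝ) + 1))) ^ Fintype.card S
          + (Fintype.card S : ℝ)) := by
  classical
  set d := Fintype.card X
  have hinv : (1 : ℝ) / 2 ^ (d + 1) < 1 :=
    (div_lt_one (by positivity)).mpr (one_lt_pow₀ one_lt_two d.succ_ne_zero)
  have hbase : (0 : ℝ) < 1 - 1 / 2 ^ (d + 1) := sub_pos.mpr hinv
  have hroot : ((1 : ℝ) - 1 / 2 ^ (d + 1)) ^ ((1 : ℝ) / ((d : ℝ) + 1)) < 1 :=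
    Real.rpow_lt_one hbase.le (sub_lt_self _ (by positivity)) (by positivity)
  refine ⟨by linarith, ?_⟩
  rcases lt_or_ge d (Fintype.card S) with hn | hn
  · refine le_max_of_le_right ?_
    have hex : ∀ p, ∃ t, (univ.image (f p)).erase p ⊆ t ∧ t ⊆ univ.erase p ∧ #t = d := by
      intro p
      refine exists_subsuperset_card_eq (erase_subset_erase p (subset_univ _)) ?_ ?_
      · exact (card_le_card (erase_subset _ _)).trans card_image_le
      · rw [card_erase_of_mem (mem_univ p), card_univ]
        omega
    choose N hsub hsup hcard using hex
    have hself : ∀ p, p ∉ N p := fun p hp => notMem_erase p univ (hsup p hp)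
    have hbound := card_filter_exists_inNeighbour_pow_le N hcard hself
    set F : Finset (Finset S) := {s | ∀ q ∈ s, ∃ p ∈ s, q ∈ N p}
    have hcover : cycles f init ⊆
        ((F.image (fun s : Finset S => (s : Set S)) ∪ univ.image (fun q : S => ({q} : Set S)) :
          Finset (Set S)) : Set (Set S)) := by
      rintro c ⟨ξ, rfl⟩
      rw [mem_coe, mem_union]
      by_cases hs : ∃ q, infOcc f init ξ = {q}
      · obtain ⟨q, hq⟩ := hs
        exact Or.inr (mem_image.mpr ⟨q, mem_univ q, hq.symm⟩)
      · push Not at hs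
        refine Or.inl (mem_image.mpr ⟨(infOcc f init ξ).toFinset, ?_, by simp⟩)
        refine mem_filter.mpr ⟨mem_univ _, fun q hq => ?_⟩
        obtain ⟨p, hp, hpq, x, hx⟩ := exists_pred_of_mem_infOcc (Set.mem_toFinset.mp hq) (hs q)
        refine ⟨p, Set.mem_toFinset.mpr hp, hsub p (mem_erase.mpr ⟨hpq.symm, ?_⟩)⟩
        exact mem_image.mpr ⟨x, mem_univ x, hx⟩
    have hcount : (cycles f init).ncard ≤ #F + Fintype.card S := by
      refine (Set.ncard_le_ncard hcover (finite_toSet _)).trans ?_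
      rw [Set.ncard_coe_finset]
      exact (card_union_le _ _).trans (add_le_add card_image_le (card_image_le.trans card_univ.le))
    have hFC : (#F : ℝ) ≤ (2 * ((1 : ℝ) - 1 / 2 ^ (d + 1)) ^ ((1 : ℝ) / ((d : ℝ) + 1))) ^
        Fintype.card S := by
      refine le_of_pow_le_pow_left₀ d.succ_ne_zero (by positivity) (hbound.trans_eq ?_)
      rw [← pow_mul, mul_comm (Fintype.card S), pow_mul]
      congr 1
      have hd1 : (d : ℝ) + 1 ≠ 0 := by positivity
      rw [mul_pow, ← Real.rpow_natCast (_ ^ _), ← Real.rpow_mul hbase.le]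
      push_cast
      rw [one_div_mul_cancel hd1, Real.rpow_one, mul_sub, mul_one,
        mul_one_div_cancel (by positivity)]
    calc ((cycles f init).ncard : ℝ) ≤ (#F : ℝ) + Fintype.card S := by exact_mod_cast hcount
      _ ≤ _ := add_le_add_left hFC _
  · refine le_max_of_le_left ?_
    have h : (cycles f init).ncard ≤ 2 ^ Fintype.card S := by
      rw [← Fintype.card_set, ← Nat.card_eq_fintype_card, ← Set.ncard_univ]
      exact Set.ncard_le_ncard (Set.subset_univ _) (Set.toFinite _)
    calc ((cycles f init).ncard : ℝ) ≤ 2 ^ Fintype.card S := by exact_mod_cast h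
      _ ≤ 2 ^ d := pow_le_pow_right₀ one_le_two hn
end

section
/- Let V be a finite set with n elements and subsets A_1, ..., A_n of V such that every v ∈ V is contained in exactly δ of the subsets (δ ≥ 1). Let 𝓕 be a family of subsets of V, and suppose f : ℕ → ℝ is a log-concave function with f ≥ 1 such that the projections 𝓕_i = { F ∩ A_i : F ∈ 𝓕 } satisfy |𝓕_i| ≤ f(|A_i|) for each i = 1, ..., n. Then |𝓕| ≤ f(δ)^{n/δ}. -/
/-- Superadditivity of the weighted geometric mean, the two-term case of Hölder's inequality. -/
theorem Real.prod_rpow_add_prod_rpow_le {ι : Type*} (s : Finset ι) (w a b : ι → ℝ)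
    (hw : ∀ i ∈ s, 0 < w i) (hw1 : ∑ i ∈ s, w i = 1)
    (ha : ∀ i ∈ s, 0 ≤ a i) (hb : ∀ i ∈ s, 0 ≤ b i) :
    ∏ i ∈ s, a i ^ w i + ∏ i ∈ s, b i ^ w i ≤ ∏ i ∈ s, (a i + b i) ^ w i := by
  have hab : ∀ i ∈ s, 0 ≤ a i + b i := fun i hi => add_nonneg (ha i hi) (hb i hi)
  by_cases h0 : ∃ i ∈ s, a i + b i = 0
  · obtain ⟨i, hi, h⟩ := h0
    have hai : a i = 0 := by linarith [ha i hi, hb i hi]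
    have hbi : b i = 0 := by linarith [ha i hi, hb i hi]
    have hz : (0 : ℝ) ^ w i = 0 := Real.zero_rpow (hw i hi).ne'
    rw [Finset.prod_eq_zero hi (by rw [hai, hz]), Finset.prod_eq_zero hi (by rw [hbi, hz]),
      Finset.prod_eq_zero hi (by rw [h, hz]), add_zero]
  · push Not at h0
    have hpos : ∀ i ∈ s, 0 < a i + b i := fun i hi => (hab i hi).lt_of_ne' (h0 i hi)
    have normalized : ∀ c : ι → ℝ, (∀ i ∈ s, 0 ≤ c i) →
        ∏ i ∈ s, c i ^ w i ≤
          (∑ i ∈ s, w i * (c i / (a i + b i))) * ∏ i ∈ s, (a i + b i) ^ w i := by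
      intro c hc
      have hgm := Real.geom_mean_le_arith_mean_weighted s w (fun i => c i / (a i + b i))
        (fun i hi => (hw i hi).le) hw1 (fun i hi => div_nonneg (hc i hi) (hab i hi))
      have hle := mul_le_mul_of_nonneg_right hgm
        (Finset.prod_nonneg fun i hi => Real.rpow_nonneg (hab i hi) (w i))
      rw [← Finset.prod_mul_distrib] at hle
      refine le_of_eq_of_le (Finset.prod_congr rfl fun i hi => ?_) hle
      rw [← Real.mul_rpow (div_nonneg (hc i hi) (hab i hi)) (hab i hi),
        div_mul_cancel₀ _ (hpos i hi).ne']
    refine (add_le_add (normalized a ha) (normalized b hb)).trans_eq ?_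
    rw [← add_mul, ← Finset.sum_add_distrib, Finset.sum_congr rfl, hw1, one_mul]
    intro i hi
    rw [← mul_add, ← add_div, div_self (hpos i hi).ne', mul_one]

/-- Splitting a family by membership of `v` splits its projection to a set that contains `v`. -/
theorem Finset.card_image_inter_subfamilies_le {V : Type*} [DecidableEq V]
    (𝓕 : Finset (Finset V)) {B : Finset V} {v : V} (hv : v ∈ B) :
    ((𝓕.nonMemberSubfamily v).image fun F => F ∩ B).card +
      ((𝓕.memberSubfamily v).image fun F => F ∩ B).card ≤ (𝓕.image fun F => F ∩ B).card := by
  rw [← Finset.card_memberSubfamily_add_card_nonMemberSubfamily v (𝓕.image fun F => F ∩ B),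
    add_comm]
  refine add_le_add (Finset.card_le_card ?_) (Finset.card_le_card ?_)
  · intro G hG
    obtain ⟨F, hF, rfl⟩ := Finset.mem_image.mp hG
    rw [Finset.mem_memberSubfamily] at hF ⊢
    refine ⟨Finset.mem_image.mpr ⟨_, hF.1, ?_⟩, fun h => hF.2 (Finset.mem_inter.mp h).1⟩
    exact Finset.insert_inter_of_mem hv
  · intro G hG
    obtain ⟨F, hF, rfl⟩ := Finset.mem_image.mp hG
    rw [Finset.mem_nonMemberSubfamily] at hF ⊢
    exact ⟨Finset.mem_image_of_mem _ hF.1, fun h => hF.2 (Finset.mem_inter.mp h).1⟩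

theorem Finset.image_inter_nonMemberSubfamily_subset {V : Type*} [DecidableEq V]
    (𝓕 : Finset (Finset V)) (B : Finset V) (v : V) :
    ((𝓕.nonMemberSubfamily v).image fun F => F ∩ B) ⊆ 𝓕.image fun F => F ∩ B :=
  Finset.image_subset_image (Finset.filter_subset _ _)

theorem Finset.image_inter_memberSubfamily_subset {V : Type*} [DecidableEq V]
    (𝓕 : Finset (Finset V)) {B : Finset V} {v : V} (hv : v ∉ B) :
    ((𝓕.memberSubfamily v).image fun F => F ∩ B) ⊆ 𝓕.image fun F => F ∩ B := by
  intro G hG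
  obtain ⟨F, hF, rfl⟩ := Finset.mem_image.mp hG
  rw [Finset.mem_memberSubfamily] at hF
  exact Finset.mem_image.mpr ⟨_, hF.1, Finset.insert_inter_of_notMem hv⟩

/-- Shearer's inequality for set families: if every element of the ground set `S` lies in exactly
`δ` of the sets `A i`, then the family is bounded by its projections to the `A i`. -/
theorem Finset.card_le_prod_card_image_inter_rpow {V ι : Type*} [DecidableEq V] [Fintype ι]
    (A : ι → Finset V) {δ : ℕ} (hδ : 1 ≤ δ) (S : Finset V)
    (hreg : ∀ v ∈ S, (Finset.univ.filter fun i => v ∈ A i).card = δ)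
    (𝓕 : Finset (Finset V)) (h𝓕 : ∀ F ∈ 𝓕, F ⊆ S) :
    (𝓕.card : ℝ) ≤ ∏ i, ((𝓕.image fun F => F ∩ A i).card : ℝ) ^ (1 / δ : ℝ) := by
  have hδ0 : (0 : ℝ) < δ := by exact_mod_cast hδ
  have hexp : (0 : ℝ) < 1 / δ := by positivity
  induction S using Finset.induction_on generalizing 𝓕 with
  | empty =>
    rcases 𝓕.eq_empty_or_nonempty with rfl | hne
    · rw [Finset.card_empty, Nat.cast_zero]
      positivity
    · have hsub : 𝓕 ⊆ {∅} := fun F hF =>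
        Finset.mem_singleton.mpr (Finset.subset_empty.mp (h𝓕 F hF))
      have hcard : (𝓕.card : ℝ) ≤ 1 := by exact_mod_cast Finset.card_le_card hsub
      refine hcard.trans (Finset.one_le_prod fun i _ => Real.one_le_rpow ?_ hexp.le)
      exact_mod_cast (hne.image _).card_pos
  | insert v S hvS ih =>
    have hreg' := fun u hu => hreg u (Finset.mem_insert_of_mem hu)
    have hnon := ih hreg' (𝓕.nonMemberSubfamily v) fun F hF => by
      rw [Finset.mem_nonMemberSubfamily] at hF
      exact (Finset.subset_insert_iff_of_notMem hF.2).mp (h𝓕 F hF.1)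
    have hmem := ih hreg' (𝓕.memberSubfamily v) fun F hF => by
      rw [Finset.mem_memberSubfamily] at hF
      exact (Finset.insert_subset_insert_iff hF.2).mp (h𝓕 _ hF.1)
    have hsplit : (𝓕.card : ℝ) =
        (𝓕.nonMemberSubfamily v).card + (𝓕.memberSubfamily v).card := by
      rw [add_comm]
      exact_mod_cast (Finset.card_memberSubfamily_add_card_nonMemberSubfamily v 𝓕).symm
    rw [hsplit]
    refine (add_le_add hnon hmem).trans ?_
    simp only [← Finset.prod_filter_mul_prod_filter_not Finset.univ (fun i => v ∈ A i)]
    have hother : ∀ 𝓖 : Finset (Finset V),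
        (∀ i, v ∉ A i → (𝓖.image fun F => F ∩ A i) ⊆ 𝓕.image fun F => F ∩ A i) →
        ∏ i with v ∉ A i, ((𝓖.image fun F => F ∩ A i).card : ℝ) ^ (1 / δ : ℝ) ≤
          ∏ i with v ∉ A i, ((𝓕.image fun F => F ∩ A i).card : ℝ) ^ (1 / δ : ℝ) := by
      intro 𝓖 h𝓖
      refine Finset.prod_le_prod (fun i _ => by positivity) fun i hi => ?_
      refine Real.rpow_le_rpow (Nat.cast_nonneg _) ?_ hexp.le
      exact_mod_cast Finset.card_le_card (h𝓖 i (Finset.mem_filter.mp hi).2)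
    refine (add_le_add
      (mul_le_mul_of_nonneg_left (hother _ fun i _ =>
        Finset.image_inter_nonMemberSubfamily_subset 𝓕 (A i) v) (by positivity))
      (mul_le_mul_of_nonneg_left (hother _ fun i hi =>
        Finset.image_inter_memberSubfamily_subset 𝓕 hi) (by positivity))).trans ?_
    rw [← add_mul]
    refine mul_le_mul_of_nonneg_right ?_ (by positivity)
    refine (Real.prod_rpow_add_prod_rpow_le _ (fun _ => (1 / δ : ℝ)) _ _ (fun _ _ => hexp) ?_
      (fun _ _ => Nat.cast_nonneg _) (fun _ _ => Nat.cast_nonneg _)).trans ?_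
    · rw [Finset.sum_const, hreg v (Finset.mem_insert_self v S), nsmul_eq_mul,
        mul_one_div_cancel hδ0.ne']
    · refine Finset.prod_le_prod (fun i _ => by positivity) fun i hi => ?_
      refine Real.rpow_le_rpow (by positivity) ?_ hexp.le
      exact_mod_cast Finset.card_image_inter_subfamilies_le 𝓕 (Finset.mem_filter.mp hi).2

/-- A concave sequence lies below its tangent at any point. -/
theorem le_add_mul_of_concave_seq (g : ℕ → ℝ) (hg : ∀ a, g a + g (a + 2) ≤ 2 * g (a + 1))
    (m a : ℕ) : g a ≤ g m + ((a : ℝ) - m) * (g (m + 1) - g m) := by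
  have hanti : Antitone fun k => g (k + 1) - g k :=
    antitone_nat_of_succ_le fun k => by linarith [hg k]
  rcases le_total m a with h | h
  · obtain ⟨k, rfl⟩ := Nat.exists_eq_add_of_le h
    clear h
    induction k with
    | zero => simp
    | succ k ih =>
      have hd : g (m + k + 1) - g (m + k) ≤ g (m + 1) - g m := hanti (Nat.le_add_right m k)
      rw [← add_assoc]
      push_cast at ih ⊢
      linarith
  · obtain ⟨k, rfl⟩ := Nat.exists_eq_add_of_le h
    clear h
    induction k with
    | zero => simp
    | succ k ih =>
      have hd : g (a + k + 1 + 1) - g (a + k + 1) ≤ g (a + k + 1) - g (a + k) :=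
        hanti (Nat.le_succ (a + k))
      have hmul := mul_le_mul_of_nonneg_left hd (by positivity : (0 : ℝ) ≤ k + 1)
      rw [← add_assoc]
      push_cast at ih ⊢
      linarith

/-- Product Theorem, special case from Björklund–Husfeldt–Kaski–Koivisto:
Let `V` be a finite set with `n` elements, with subsets `A 1, …, A n` such that every
`v ∈ V` lies in exactly `δ ≥ 1` of them. If `𝓕` is a family of subsets of `V` and
`f : ℕ → ℝ` is a log-concave function with `f ≥ 1` such that each projection
`{F ∩ A i | F ∈ 𝓕}` has at most `f |A i|` elements, then `|𝓕| ≤ f δ ^ (n / δ)`. -/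
theorem stmt_5 {V : Type*} [Fintype V] [DecidableEq V] (n : ℕ) (hn : Fintype.card V = n)
    (A : Fin n → Finset V) (δ : ℕ) (hδ : 1 ≤ δ)
    (hreg : ∀ v : V, (Finset.univ.filter fun i : Fin n => v ∈ A i).card = δ)
    (𝓕 : Finset (Finset V)) (f : ℕ → ℝ)
    (hf1 : ∀ a : ℕ, 1 ≤ f a)
    (hconc : ∀ a : ℕ, 1 ≤ a → f (a - 1) * f (a + 1) ≤ f a ^ 2)
    (hproj : ∀ i : Fin n, ((𝓕.image fun F => F ∩ A i).card : ℝ) ≤ f (A i).card) :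
    (𝓕.card : ℝ) ≤ f δ ^ ((n : ℝ) / (δ : ℝ)) := by
  have hδ0 : (0 : ℝ) < δ := by exact_mod_cast hδ
  have hfpos : ∀ a, 0 < f a := fun a => one_pos.trans_le (hf1 a)
  have hlog : ∀ a, Real.log (f a) + Real.log (f (a + 2)) ≤ 2 * Real.log (f (a + 1)) := by
    intro a
    have h := Real.log_le_log (mul_pos (hfpos _) (hfpos _)) (hconc (a + 1) (Nat.le_add_left 1 a))
    rwa [Real.log_mul (hfpos _).ne' (hfpos _).ne', Real.log_pow] at h
  have hdouble : ∑ i, ((A i).card : ℝ) = n * δ := by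
    have h : ∑ i, (A i).card = Fintype.card V * δ := by
      have hcount := Finset.sum_card_bipartiteAbove_eq_sum_card_bipartiteBelow
        (s := (Finset.univ : Finset V)) (t := (Finset.univ : Finset (Fin n)))
        (fun v i => v ∈ A i)
      simp only [Finset.bipartiteAbove, Finset.bipartiteBelow, hreg, Finset.sum_const,
        Finset.card_univ, smul_eq_mul, Finset.filter_univ_mem] at hcount
      exact hcount.symm
    rw [hn] at h
    exact_mod_cast h
  have hsum : ∑ i, Real.log (f (A i).card) ≤ n * Real.log (f δ) := by
    refine (Finset.sum_le_sum fun i _ =>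
      le_add_mul_of_concave_seq (fun a => Real.log (f a)) hlog δ (A i).card).trans_eq ?_
    rw [Finset.sum_add_distrib, ← Finset.sum_mul, Finset.sum_sub_distrib, hdouble]
    simp
  calc (𝓕.card : ℝ)
      ≤ ∏ i, ((𝓕.image fun F => F ∩ A i).card : ℝ) ^ (1 / δ : ℝ) :=
        Finset.card_le_prod_card_image_inter_rpow A hδ Finset.univ (fun v _ => hreg v) 𝓕
          fun F _ => Finset.subset_univ F
    _ ≤ ∏ i, f (A i).card ^ (1 / δ : ℝ) :=
        Finset.prod_le_prod (fun i _ => by positivity) fun i _ =>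
          Real.rpow_le_rpow (Nat.cast_nonneg _) (hproj i) (by positivity)
    _ = Real.exp ((∑ i, Real.log (f (A i).card)) * (1 / δ)) := by
        simp only [Real.rpow_def_of_pos (hfpos _), ← Real.exp_sum, Finset.sum_mul]
    _ ≤ Real.exp (n * Real.log (f δ) * (1 / δ)) :=
        Real.exp_le_exp.mpr (mul_le_mul_of_nonneg_right hsum (by positivity))
    _ = f δ ^ ((n : ℝ) / (δ : ℝ)) := by
        rw [Real.rpow_def_of_pos (hfpos δ)]
        congr 1
        ring
end

section
/- Let M = (Q, f, in) be a deterministic automaton over alphabet X. Every cycle c ∈ C_M is contained in the vertex set of exactly one strongly connected component of the transition graph of M, this component is reachable from the initial state, and two cycles c, d ∈ C_M satisfy c ≡_0 d if and only if they are contained in the same strongly connected component. Hence the ≡_0-equivalence classes of cycles correspond injectively to reachable strongly connected components, with the largest cycle of a class equal to the vertex set of the corresponding component. -/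
/-- The preorder `≤₀` on cycles: `le0 f c d` iff some state in `d` is reachable
from some state in `c`. -/
def le0 {S X : Type*} (f : S → X → S) (c d : Set S) : Prop :=
  ∃ q ∈ d, ∃ p ∈ c, Reach f p q

/-- The equivalence relation `≡₀` induced by the preorder `≤₀`. -/
def equiv0 {S X : Type*} (f : S → X → S) (c d : Set S) : Prop :=
  le0 f c d ∧ le0 f d c

/-- The strongly connected component of the state `q` in the transition graph:
the set of states mutually reachable with `q`. -/
def Scc {S X : Type*} (f : S → X → S) (q : S) : Set S :=
  {p | Reach f q p ∧ Reach f p q}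

theorem Reach.refl {S X : Type*} (f : S → X → S) (p : S) : Reach f p p := ⟨[], rfl⟩

theorem fext_append {S X : Type*} (f : S → X → S) (p : S) (u v : List X) :
    fext f p (u ++ v) = fext f (fext f p u) v :=
  List.foldl_append

theorem Reach.trans {S X : Type*} {f : S → X → S} {p q r : S} (hpq : Reach f p q)
    (hqr : Reach f q r) : Reach f p r := by
  obtain ⟨u, rfl⟩ := hpq
  obtain ⟨v, rfl⟩ := hqr
  exact ⟨u ++ v, fext_append f p u v⟩

theorem reach_run_of_le {S X : Type*} (f : S → X → S) (init : S) (ξ : ℕ → X) {m n : ℕ}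
    (hmn : m ≤ n) : Reach f (run f init ξ m) (run f init ξ n) := by
  induction n, hmn using Nat.le_induction with
  | base => exact Reach.refl f _
  | succ n _ ih => exact ih.trans ⟨[ξ n], rfl⟩

theorem reach_of_mem_infOcc {S X : Type*} {f : S → X → S} {init : S} {ξ : ℕ → X} {p q : S}
    (hp : p ∈ infOcc f init ξ) (hq : q ∈ infOcc f init ξ) : Reach f p q := by
  obtain ⟨m, rfl⟩ := Set.Infinite.nonempty hp
  obtain ⟨n, rfl, hmn⟩ := Set.Infinite.exists_gt hq m
  exact reach_run_of_le f init ξ hmn.le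

theorem reach_of_mem_cycle {S X : Type*} {f : S → X → S} {init : S} {c : Set S}
    (hc : c ∈ cycles f init) {p q : S} (hp : p ∈ c) (hq : q ∈ c) : Reach f p q := by
  obtain ⟨ξ, rfl⟩ := hc
  exact reach_of_mem_infOcc hp hq

theorem reach_init_of_mem_cycle {S X : Type*} {f : S → X → S} {init : S} {c : Set S}
    (hc : c ∈ cycles f init) {p : S} (hp : p ∈ c) : Reach f init p := by
  obtain ⟨ξ, rfl⟩ := hc
  obtain ⟨n, rfl⟩ := Set.Infinite.nonempty hp
  exact reach_run_of_le f init ξ (Nat.zero_le n)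

theorem cycle_nonempty {S X : Type*} [Finite S] {f : S → X → S} {init : S} {c : Set S}
    (hc : c ∈ cycles f init) : c.Nonempty := by
  obtain ⟨ξ, rfl⟩ := hc
  obtain ⟨p, hp⟩ := Finite.exists_infinite_fiber (run f init ξ)
  exact ⟨p, Set.infinite_coe_iff.mp hp⟩

theorem Scc_eq_of_mem {S X : Type*} {f : S → X → S} {p q : S} (hp : p ∈ Scc f q) :
    Scc f p = Scc f q :=
  Set.ext fun _ => ⟨fun h => ⟨hp.1.trans h.1, h.2.trans hp.2⟩,
    fun h => ⟨hp.2.trans h.1, h.2.trans hp.1⟩⟩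

theorem cycle_subset_Scc {S X : Type*} {f : S → X → S} {init : S} {c : Set S}
    (hc : c ∈ cycles f init) {q : S} (hq : q ∈ c) : c ⊆ Scc f q :=
  fun _ hp => ⟨reach_of_mem_cycle hc hq hp, reach_of_mem_cycle hc hp hq⟩

theorem subset_Scc_of_equiv0 {S X : Type*} {f : S → X → S} {init : S} {c d : Set S}
    (hc : c ∈ cycles f init) (hd : d ∈ cycles f init) (h : equiv0 f c d) {q : S} (hq : q ∈ c) :
    d ⊆ Scc f q := by
  obtain ⟨⟨b, hb, a, ha, hab⟩, ⟨a₂, ha₂, b₂, hb₂, hba⟩⟩ := h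
  intro p hp
  exact ⟨((reach_of_mem_cycle hc hq ha).trans hab).trans (reach_of_mem_cycle hd hb hp),
    ((reach_of_mem_cycle hd hp hb₂).trans hba).trans (reach_of_mem_cycle hc ha₂ hq)⟩

/-- A state of a cycle returns to itself along a nonempty word. -/
theorem exists_loop_of_mem_cycle {S X : Type*} {f : S → X → S} {init : S} {c : Set S}
    (hc : c ∈ cycles f init) {q : S} (hq : q ∈ c) : ∃ w : List X, w ≠ [] ∧ fext f q w = q := by
  obtain ⟨ξ, rfl⟩ := hc
  obtain ⟨m, hm⟩ := Set.Infinite.nonempty hq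
  obtain ⟨n, hn, hmn⟩ := Set.Infinite.exists_gt hq m
  obtain ⟨w, hw⟩ := reach_run_of_le f init ξ (Nat.succ_le_of_lt hmn)
  refine ⟨ξ m :: w, List.cons_ne_nil _ _, ?_⟩
  have hm' : run f init ξ m = q := hm
  have hn' : run f init ξ n = q := hn
  rw [hn'] at hw
  rw [← hm'] at hw ⊢
  exact hw

/-- A nonempty closed walk at `q` can be extended to visit any finite set of states of the
strongly connected component of `q`. -/
theorem exists_loop_visiting {S X : Type*} {f : S → X → S} {q : S}
    (hloop : ∃ w : List X, w ≠ [] ∧ fext f q w = q) (T : Finset S) (hT : ↑T ⊆ Scc f q) :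
    ∃ w : List X, w ≠ [] ∧ fext f q w = q ∧ ∀ p ∈ T, ∃ v, v <+: w ∧ fext f q v = p := by
  classical
  induction T using Finset.induction_on with
  | empty =>
    obtain ⟨w, hw, hq⟩ := hloop
    exact ⟨w, hw, hq, by simp⟩
  | insert p T _ ih =>
    rw [Finset.coe_insert, Set.insert_subset_iff] at hT
    obtain ⟨w, hw, hq, hv⟩ := ih hT.2
    obtain ⟨⟨a, ha⟩, ⟨b, hb⟩⟩ := hT.1
    refine ⟨w ++ a ++ b, by simp [hw], by simp only [fext_append, hq, ha, hb], ?_⟩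
    intro r hr
    rcases Finset.mem_insert.mp hr with rfl | hr
    · exact ⟨w ++ a, List.prefix_append _ _, by simp only [fext_append, hq, ha]⟩
    · obtain ⟨v, hvw, hvr⟩ := hv r hr
      exact ⟨v, (hvw.trans (List.prefix_append _ _)).trans (List.prefix_append _ _), hvr⟩

theorem run_cons_succ {S X : Type*} (f : S → X → S) (p : S) (x : X) (ξ : Stream' X) (n : ℕ) :
    run f p (Stream'.cons x ξ) (n + 1) = run f (f p x) ξ n := by
  induction n with
  | zero => rfl
  | succ n ih => exact congrArg (f · (ξ n)) ih

theorem run_append_add {S X : Type*} (f : S → X → S) (p : S) (u : List X) (ξ : Stream' X)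
    (n : ℕ) : run f p (u ++ₛ ξ) (u.length + n) = run f (fext f p u) ξ n := by
  induction u generalizing p with
  | nil => simp [fext]
  | cons x u ih =>
    rw [List.length_cons, Nat.add_right_comm, Stream'.cons_append_stream, run_cons_succ, ih]
    rfl

theorem run_cycle_mul_add {S X : Type*} {f : S → X → S} {q : S} {w : List X} (hw : w ≠ [])
    (hq : fext f q w = q) (k n : ℕ) :
    run f q (Stream'.cycle w hw) (k * w.length + n) = run f q (Stream'.cycle w hw) n := by
  induction k with
  | zero => simp
  | succ k ih =>
    rw [Stream'.cycle_eq, Nat.succ_mul, Nat.add_comm (k * w.length), Nat.add_assoc,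
      run_append_add, hq, ih, ← Stream'.cycle_eq]

theorem run_cycle_length {S X : Type*} {f : S → X → S} {q : S} {v w : List X} (hw : w ≠ [])
    (hvw : v <+: w) : run f q (Stream'.cycle w hw) v.length = fext f q v := by
  obtain ⟨t, rfl⟩ := hvw
  rw [Stream'.cycle_eq, Stream'.append_append_stream]
  exact run_append_add f q v _ 0

theorem Scc_mem_cycles {S X : Type*} [Finite S] {f : S → X → S} {init q : S}
    (hreach : Reach f init q) (hloop : ∃ w : List X, w ≠ [] ∧ fext f q w = q) :
    Scc f q ∈ cycles f init := by
  obtain ⟨u, hu⟩ := hreach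
  obtain ⟨w, hw, hq, hv⟩ :=
    exists_loop_visiting hloop (Set.toFinite (Scc f q)).toFinset (by simp)
  have hlen : 0 < w.length := List.length_pos_iff.mpr hw
  refine ⟨u ++ₛ Stream'.cycle w hw, Set.Subset.antisymm ?_ ?_⟩
  · intro p hp
    obtain ⟨n, hn, hun⟩ := Set.Infinite.exists_gt hp u.length
    obtain ⟨m, rfl⟩ := Nat.exists_eq_add_of_le hun.le
    have hn' : run f init (u ++ₛ Stream'.cycle w hw) (u.length + m) = p := hn
    rw [run_append_add, hu] at hn'
    subst hn'
    refine ⟨reach_run_of_le f q (Stream'.cycle w hw) (Nat.zero_le m), ?_⟩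
    have hback := reach_run_of_le f q (Stream'.cycle w hw)
      (show m ≤ m * w.length + 0 from Nat.le_mul_of_pos_right m hlen)
    rw [run_cycle_mul_add hw hq] at hback
    exact hback
  · intro p hp
    obtain ⟨v, hvw, rfl⟩ := hv p (by simpa using hp)
    refine Set.infinite_of_injective_forall_mem
      (f := fun k : ℕ => u.length + (k * w.length + v.length)) ?_ ?_
    · intro k l hkl
      exact Nat.eq_of_mul_eq_mul_right hlen (by simpa using hkl)
    · intro k
      change run f init _ _ = _
      rw [run_append_add, hu, run_cycle_mul_add hw hq, run_cycle_length hw hvw]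

/-- Every cycle `c ∈ C_M` is contained in exactly one strongly
connected component of the transition graph; this component is reachable from
the initial state; two cycles satisfy `c ≡₀ d` iff they are contained in the same
SCC; and the vertex set of the SCC of any state of `c` is itself a cycle which
contains every cycle `≡₀`-equivalent to `c` (the largest cycle of the class). -/
theorem stmt_10 {S X : Type*} [Fintype S] [Nonempty S] [Fintype X]
    (f : S → X → S) (init : S) (c : Set S) (hc : c ∈ cycles f init) :
    (∃! s : Set S, (∃ q : S, s = Scc f q) ∧ c ⊆ s) ∧
    (∀ s : Set S, (∃ q : S, s = Scc f q) → c ⊆ s → ∀ p ∈ s, Reach f init p) ∧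
    (∀ d ∈ cycles f init,
      (equiv0 f c d ↔ ∃ q : S, c ⊆ Scc f q ∧ d ⊆ Scc f q)) ∧
    (∀ q ∈ c, Scc f q ∈ cycles f init ∧
      ∀ d ∈ cycles f init, equiv0 f c d → d ⊆ Scc f q) := by
  obtain ⟨q₀, hq₀⟩ := cycle_nonempty hc
  refine ⟨⟨Scc f q₀, ⟨⟨q₀, rfl⟩, cycle_subset_Scc hc hq₀⟩, ?_⟩, ?_, ?_, ?_⟩
  · rintro s ⟨⟨q, rfl⟩, hs⟩
    exact (Scc_eq_of_mem (hs hq₀)).symm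
  · rintro s ⟨q, rfl⟩ hs p hp
    exact (reach_init_of_mem_cycle hc hq₀).trans ((hs hq₀).2.trans hp.1)
  · intro d hd
    refine ⟨fun h => ⟨q₀, cycle_subset_Scc hc hq₀, subset_Scc_of_equiv0 hc hd h hq₀⟩, ?_⟩
    rintro ⟨q, hcq, hdq⟩
    obtain ⟨p, hp⟩ := cycle_nonempty hd
    exact ⟨⟨p, hp, q₀, hq₀, (hcq hq₀).2.trans (hdq hp).1⟩,
      ⟨q₀, hq₀, p, hp, (hdq hp).2.trans (hcq hq₀).1⟩⟩
  · intro q hq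
    exact ⟨Scc_mem_cycles (reach_init_of_mem_cycle hc hq) (exists_loop_of_mem_cycle hc hq),
      fun d hd h => subset_Scc_of_equiv0 hc hd h hq⟩
end

section
/- Let Q be a preorder and P, R Q-posets. If P ≤_h R (there is a morphism from P to R), then u(P) ≤_h u(R), i.e., P ⪯ R. -/
/-- In a finite poset, `a ≤ b` is witnessed by a covering chain from `a` to `b`. -/
theorem exists_covBy_chain_of_le {R : Type*} [PartialOrder R] [Finite R] {a b : R} (h : a ≤ b) :
    ∃ l : List R, (a :: l).IsChain (· ⋖ ·) ∧ (a :: l).getLast (List.cons_ne_nil _ _) = b := by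
  classical
  have := Fintype.ofFinite R
  let _ : LocallyFiniteOrder R := Fintype.toLocallyFiniteOrder
  exact List.exists_isChain_cons_of_relationReflTransGen (le_iff_reflTransGen_covBy.1 h)

/-- Starting at `r`, concatenate the segments `seg` joining successive elements of the list. -/
def concatSegments {R : Type*} (seg : R → R → List R) : R → List R → List R
  | _, [] => []
  | r, x :: xs => seg r x ++ concatSegments seg x xs

theorem concatSegments_prefix {R : Type*} (seg : R → R → List R) (r : R) {l l' : List R}
    (h : l <+: l') : concatSegments seg r l <+: concatSegments seg r l' := by
  induction l generalizing r l' with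
  | nil => exact List.nil_prefix
  | cons x xs ih =>
    obtain ⟨t, rfl⟩ := h
    exact (List.prefix_append_right_inj _).2 (ih x (List.prefix_append xs t))

/-- Concatenating covering chains between successive elements of a weakly increasing list gives a
covering chain with the same last element. -/
theorem concatSegments_spec {R : Type*} [PartialOrder R] (seg : R → R → List R)
    (hseg : ∀ a b, a ≤ b → (a :: seg a b).IsChain (· ⋖ ·) ∧
      (a :: seg a b).getLast (List.cons_ne_nil _ _) = b)
    (r : R) (l : List R) (hl : (r :: l).IsChain (· ≤ ·)) :
    (r :: concatSegments seg r l).IsChain (· ⋖ ·) ∧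
      (r :: concatSegments seg r l).getLast (List.cons_ne_nil _ _) =
        (r :: l).getLast (List.cons_ne_nil _ _) := by
  induction l generalizing r with
  | nil => simp [concatSegments]
  | cons x xs ih =>
    obtain ⟨hrx, hxs⟩ := List.isChain_cons_cons.1 hl
    obtain ⟨hchain, hlast⟩ := hseg r x hrx
    obtain ⟨ihchain, ihlast⟩ := ih x hxs
    rw [List.getLast_cons_cons, ← ihlast]
    simp only [concatSegments, ← List.cons_append]
    constructor
    · refine hchain.append ihchain.tail ?_
      intro a ha b hb
      rw [List.getLast?_eq_getLast_of_ne_nil (List.cons_ne_nil _ _), hlast, Option.mem_some] at ha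
      subst ha
      exact (List.isChain_cons.1 ihchain).1 b hb
    · by_cases hG : concatSegments seg x xs = []
      · simpa [hG] using hlast
      · rw [List.getLast_append_of_ne_nil _ hG, List.getLast_cons hG]

/-- If `P ≤_h R` (there is a morphism from `P` to `R`) then
`u(P) ≤_h u(R)`, i.e. `P ⪯ R`. -/
theorem stmt_13 {Q : Type*} [Preorder Q] {P R : Type*}
    [PartialOrder P] [Fintype P] [Nonempty P]
    [PartialOrder R] [Fintype R] [Nonempty R]
    (cP : P → Q) (cR : R → Q) (h : Hle cP cR) :
    Hle (unfLabel cP) (unfLabel cR) := by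
  obtain ⟨f, hf, hc⟩ := h
  have hex : ∀ a b : R, ∃ l : List R, a ≤ b → (a :: l).IsChain (· ⋖ ·) ∧
      (a :: l).getLast (List.cons_ne_nil _ _) = b := fun a b => by
    by_cases hab : a ≤ b
    · obtain ⟨l, hl⟩ := exists_covBy_chain_of_le hab
      exact ⟨l, fun _ => hl⟩
    · exact ⟨[], fun h => absurd h hab⟩
  choose seg hseg using hex
  have hmin : ∀ a : R, ∃ m, m ≤ a ∧ IsMin m := fun a => by
    obtain ⟨m, hma, hm⟩ := Set.finite_univ.exists_le_minimal (Set.mem_univ a)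
    exact ⟨m, hma, fun b hb => hm.2 (Set.mem_univ b) hb⟩
  choose m hma hm using hmin
  let start (l : Unf P) : R := m (f (l.1.head l.2.1))
  have hspec (l : Unf P) := concatSegments_spec seg hseg (start l) (l.1.map f) (by
    obtain ⟨_ | ⟨x, xs⟩, hne, _, hl⟩ := l
    · exact absurd rfl hne
    · refine List.isChain_cons_cons.2 ⟨hma _, ?_⟩
      exact List.isChain_map_of_isChain f (fun a b hab => hf hab.le) hl)
  refine ⟨fun l => ⟨start l :: concatSegments seg (start l) (l.1.map f), List.cons_ne_nil _ _,
    by simpa using hm _, (hspec l).1⟩, ?_, ?_⟩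
  · intro l l' hle
    have hstart : start l = start l' := by
      simp only [start, hle.head l.2.1]
    change start l :: _ <+: start l' :: _
    rw [hstart, List.prefix_cons_inj]
    exact concatSegments_prefix seg _ (hle.map f)
  · intro l
    refine (hc _).trans_eq (congrArg cR ?_)
    refine Eq.trans ?_ (hspec l).2.symm
    simp [lastOf, List.getLast_cons, l.2.1]
end

section
/- Let Q be a preorder and P a Q-poset. Then u(P) ≤_h P (indeed, the map sending each covering chain to its last element is a morphism from u(P) onto P), and u(P) is a largest element of the set {G a Q-forest : G ≤_h P} with respect to ≤_h: for every Q-forest G with G ≤_h P, one has G ≤_h u(P). -/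
theorem lastOf_monotone {P : Type*} [PartialOrder P] : Monotone (lastOf : Unf P → P) := by
  rintro ⟨a, ha⟩ ⟨b, hb⟩ hab
  obtain ⟨t, rfl⟩ : a <+: b := hab
  rcases List.eq_nil_or_concat' t with rfl | ⟨s, y, rfl⟩
  · simp [lastOf]
  · have hsorted : (a ++ (s ++ [y])).Pairwise (· < ·) :=
      List.isChain_iff_pairwise.mp (hb.2.2.imp fun _ _ h => h.lt)
    have hlt := (List.pairwise_append.mp hsorted).2.2 _ (List.getLast_mem ha.1) y (by simp)
    simpa [lastOf] using hlt.le

theorem exists_le_lastOf_eq_of_covBy {P : Type*} [PartialOrder P] (a : Unf P) {p : P}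
    (h : lastOf a ⋖ p) : ∃ b : Unf P, a ≤ b ∧ lastOf b = p := by
  obtain ⟨l, hl⟩ := a
  refine ⟨⟨l ++ [p], by simp, ?_, ?_⟩, List.prefix_append _ _, by simp [lastOf]⟩
  · rw [List.head?_append_of_ne_nil _ hl.1]
    exact hl.2.1
  · refine List.isChain_append.mpr ⟨hl.2.2, List.isChain_singleton p, ?_⟩
    intro x hx y hy
    rw [List.getLast?_eq_getLast_of_ne_nil hl.1] at hx
    simp only [Option.mem_def, Option.some.injEq, List.head?_cons] at hx hy
    subst hx hy
    exact h

theorem exists_le_lastOf_eq {P : Type*} [PartialOrder P] [Finite P] (a : Unf P) {p : P}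
    (h : lastOf a ≤ p) : ∃ b : Unf P, a ≤ b ∧ lastOf b = p := by
  induction p using WellFoundedLT.induction with
  | ind p ih =>
    rcases h.eq_or_lt with rfl | hlt
    · exact ⟨a, le_rfl, rfl⟩
    · obtain ⟨q, haq, hqp⟩ := exists_le_covBy_of_lt hlt
      obtain ⟨b, hab, rfl⟩ := ih q hqp.lt haq
      obtain ⟨d, hbd, hd⟩ := exists_le_lastOf_eq_of_covBy b hqp
      exact ⟨d, hab.trans hbd, hd⟩

theorem lastOf_surjective {P : Type*} [PartialOrder P] [Finite P] :
    Function.Surjective (lastOf : Unf P → P) := by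
  intro p
  obtain ⟨m, hmp, hm⟩ := Set.toFinite (Set.univ : Set P) |>.exists_le_minimal (Set.mem_univ p)
  have hmin : IsMin m := fun q hq => hm.2 (Set.mem_univ q) hq
  let a : Unf P := ⟨[m], by simp, by simpa using hmin, List.isChain_singleton m⟩
  obtain ⟨b, -, hb⟩ := exists_le_lastOf_eq a (p := p) hmp
  exact ⟨b, hb⟩

/-- Every monotone map from a finite forest to `P` lifts to a monotone map to the unfolding. -/
theorem exists_monotone_lift {G P : Type*} [PartialOrder G] [Finite G] [PartialOrder P] [Finite P]
    (hG : ∀ x : G, IsChain (· ≤ ·) {y : G | y ≤ x}) {f : G → P} (hf : Monotone f) :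
    ∃ g : G → Unf P, Monotone g ∧ ∀ x, lastOf (g x) = f x := by
  classical
  have hext : ∀ (a : Unf P) (p : P), ∃ b : Unf P, lastOf b = p ∧ (lastOf a ≤ p → a ≤ b) := by
    intro a p
    by_cases h : lastOf a ≤ p
    · obtain ⟨b, hab, hb⟩ := exists_le_lastOf_eq a h
      exact ⟨b, hb, fun _ => hab⟩
    · obtain ⟨b, hb⟩ := lastOf_surjective p
      exact ⟨b, hb, fun h' => absurd h' h⟩
  choose ext hext_last hext_le using hext
  choose start hstart using lastOf_surjective (P := P)
  let step (x : G) (ih : ∀ y, y < x → Unf P) : Unf P :=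
    if h : ∃ y, y ⋖ x then ext (ih h.choose h.choose_spec.lt) (f x) else start (f x)
  let g : G → Unf P := IsWellFounded.fix (· < ·) step
  have hg : ∀ x, g x = step x fun y _ => g y := IsWellFounded.fix_eq (· < ·) step
  have hlast : ∀ x, lastOf (g x) = f x := by
    intro x
    rw [hg]
    by_cases h : ∃ y, y ⋖ x
    · simp only [step, dif_pos h, hext_last]
    · simp only [step, dif_neg h, hstart]
  refine ⟨g, ?_, hlast⟩
  intro x z hxz
  induction z using WellFoundedLT.induction with
  | ind z ih =>
    rcases hxz.eq_or_lt with rfl | hlt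
    · exact le_rfl
    · obtain ⟨w, -, hw⟩ := exists_le_covBy_of_lt hlt
      have h : ∃ y, y ⋖ z := ⟨w, hw⟩
      have hy := h.choose_spec
      have hxy : x ≤ h.choose := by
        rcases (hG z).total hxz hy.le with hle | hle
        · exact hle
        · exact (hle.eq_of_not_lt fun hyx => hy.2 hyx hlt).ge
      refine (ih _ hy.lt hxy).trans ?_
      rw [hg z]
      simp only [step, dif_pos h]
      exact hext_le _ _ (by rw [hlast]; exact hf hy.le)

/-- `u(P) ≤_h P`; indeed the map sending each covering chain to its
last element is a (label-nonincreasing) monotone surjection from `u(P)` onto `P`.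
Moreover `u(P)` is a largest element of `{G a Q-forest | G ≤_h P}` w.r.t. `≤_h`:
every finite `Q`-forest `G` with `G ≤_h P` satisfies `G ≤_h u(P)`. -/
theorem stmt_14 {Q : Type*} [Preorder Q] {P : Type*}
    [PartialOrder P] [Fintype P] [Nonempty P] (c : P → Q) :
    (Monotone (lastOf : Unf P → P) ∧ Function.Surjective (lastOf : Unf P → P) ∧
      ∀ l : Unf P, unfLabel c l ≤ c (lastOf l)) ∧
    (∀ (G : Type) (_ : PartialOrder G) (_ : Fintype G) (_ : Nonempty G) (cG : G → Q),
      (∀ x : G, IsChain (· ≤ ·) {y : G | y ≤ x}) →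
      Hle cG c → Hle cG (unfLabel c)) := by
  refine ⟨⟨lastOf_monotone, lastOf_surjective, fun _ => le_rfl⟩, ?_⟩
  rintro G _ _ _ cG hG ⟨f, hf, hc⟩
  obtain ⟨g, hg, hlast⟩ := exists_monotone_lift hG hf
  exact ⟨g, hg, fun x => by simpa [unfLabel, hlast] using hc x⟩
end
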